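/- arXiv:2511.18064 — 7 statements merged into one kernel-verified Lean document; each statement's English description precedes it below -/
import Mathlib

section
/- Let G be an infinite commutative group, M̄ an upper mean on G, f : G → ℝ a bounded function, (cᵢ)_{i∈ℕ} a sequence of real numbers with ∑ᵢ |cᵢ| < ∞ and ∑ᵢ cᵢ ≥ 0, and (tᵢ)_{i∈ℕ} a sequence of elements of G. Then the function g(x) = ∑ᵢ cᵢ·f(x + tᵢ) is bounded and M̄(g) = (∑ᵢ cᵢ)·M̄(f). -/
open scoped Pointwise BigOperators
open Filter

/-- A real function on `G` is bounded. -/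
def Bounded {G : Type*} (f : G → ℝ) : Prop :=
  ∃ C : ℝ, ∀ x, |f x| ≤ C

/-- An upper mean on the bounded real functions on a commutative group `G`. -/
structure IsUpperMean (G : Type*) [AddCommGroup G] (M : (G → ℝ) → ℝ) : Prop where
  norming : ∀ c : ℝ, M (fun _ => c) = c
  mono : ∀ f g : G → ℝ, Bounded f → Bounded g → (∀ x, f x ≤ g x) → M f ≤ M g
  homog : ∀ c : ℝ, 0 ≤ c → ∀ f : G → ℝ, Bounded f → M (fun x => c * f x) = c * M f
  restr_add : ∀ f : G → ℝ, Bounded f → ∀ t : G, M (fun x => f x + f (x + t)) = 2 * M f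
  subadd : ∀ f g : G → ℝ, Bounded f → Bounded g → M (fun x => f x + g x) ≤ M f + M g

/-- A lower mean on the bounded real functions on a commutative group `G`. -/
structure IsLowerMean (G : Type*) [AddCommGroup G] (M : (G → ℝ) → ℝ) : Prop where
  norming : ∀ c : ℝ, M (fun _ => c) = c
  mono : ∀ f g : G → ℝ, Bounded f → Bounded g → (∀ x, f x ≤ g x) → M f ≤ M g
  homog : ∀ c : ℝ, 0 ≤ c → ∀ f : G → ℝ, Bounded f → M (fun x => c * f x) = c * M f
  restr_add : ∀ f : G → ℝ, Bounded f → ∀ t : G, M (fun x => f x + f (x + t)) = 2 * M f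
  superadd : ∀ f g : G → ℝ, Bounded f → Bounded g → M f + M g ≤ M (fun x => f x + g x)

/-- `f` and `f'` are commarginal: marginals of a bounded `F` supported near the diagonal. -/
def Commarginal {G : Type*} [AddCommGroup G] (f f' : G → ℝ) : Prop :=
  ∃ (F : G → G → ℝ) (B : Finset G),
    (∃ C : ℝ, ∀ x y, |F x y| ≤ C) ∧
    (∀ x y, F x y ≠ 0 → x - y ∈ B) ∧
    (∀ x, ∑ᶠ y, F x y = f x) ∧
    (∀ y, ∑ᶠ x, F x y = f' y)

/-- Uniform convergence of a sequence of functions. -/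
def UnifLim {G : Type*} (g : ℕ → G → ℝ) (f : G → ℝ) : Prop :=
  ∀ ε : ℝ, 0 < ε → ∃ N : ℕ, ∀ n ≥ N, ∀ x, |g n x - f x| < ε

/-- `f` and `f'` are limit-commarginal. -/
def LimitCommarginal {G : Type*} [AddCommGroup G] (f f' : G → ℝ) : Prop :=
  ∃ g g' : ℕ → G → ℝ, (∀ n, Bounded (g n)) ∧ (∀ n, Bounded (g' n)) ∧
    (∀ n, Commarginal (g n) (g' n)) ∧ UnifLim g f ∧ UnifLim g' f'

/-- `g` is a finite convex combination of translates of `f`. -/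
def ConvexCombTranslates {G : Type*} [AddCommGroup G] (f g : G → ℝ) : Prop :=
  ∃ (n : ℕ) (c : Fin n → ℝ) (t : Fin n → G),
    (∀ i, 0 ≤ c i) ∧ (∑ i, c i) = 1 ∧ ∀ x, g x = ∑ i, c i * f (x + t i)

/-- The uppermost mean `M*`. -/
noncomputable def Mstar {G : Type*} [AddCommGroup G] (f : G → ℝ) : ℝ :=
  sInf {a : ℝ | ∃ g : G → ℝ, ConvexCombTranslates f g ∧ a = sSup (Set.range g)}

/-- The lowest mean `M_*`. -/
noncomputable def Mlowstar {G : Type*} [AddCommGroup G] (f : G → ℝ) : ℝ :=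
  sSup {a : ℝ | ∃ g : G → ℝ, ConvexCombTranslates f g ∧ a = sInf (Set.range g)}

/-- The `B`-average `(f|B)(t)` of `f`. -/
noncomputable def avg {G : Type*} [AddCommGroup G] (f : G → ℝ) (B : Finset G) (t : G) : ℝ :=
  (∑ b ∈ B, f (b + t)) / (B.card : ℝ)

/-- The expansion pseudomean `E(f)`. -/
noncomputable def Epm {G : Type*} [AddCommGroup G] [DecidableEq G] (f : G → ℝ) : ℝ :=
  ⨅ T : {T : Finset G // T.Nonempty}, ⨆ B : {B : Finset G // B.Nonempty},
    (∑ b ∈ B.1, f b) / (((B.1 + T.1).card : ℝ))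

/-- A finite nonempty `Y ⊆ G` is a tile: some set `Z` of translates partitions `G`. -/
def IsTile {G : Type*} [AddCommGroup G] (Y : Finset G) : Prop :=
  Y.Nonempty ∧ ∃ Z : Set G, ∀ x : G, ∃! p : Y × Z, (p.1 : G) + (p.2 : G) = x

theorem Bounded.add {G : Type*} {f g : G → ℝ} (hf : Bounded f) (hg : Bounded g) :
    Bounded (fun x => f x + g x) := by
  obtain ⟨C, hC⟩ := hf
  obtain ⟨D, hD⟩ := hg
  exact ⟨C + D, fun x => (abs_add_le _ _).trans (add_le_add (hC x) (hD x))⟩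

theorem Bounded.const_mul {G : Type*} {f : G → ℝ} (hf : Bounded f) (c : ℝ) :
    Bounded (fun x => c * f x) := by
  obtain ⟨C, hC⟩ := hf
  refine ⟨|c| * C, fun x => ?_⟩
  rw [abs_mul]
  exact mul_le_mul_of_nonneg_left (hC x) (abs_nonneg c)

theorem Bounded.translate_sub {G : Type*} [AddCommGroup G] {f : G → ℝ} (hf : Bounded f) (t : G) :
    Bounded (fun x => f (x + t) - f x) := by
  obtain ⟨C, hC⟩ := hf
  exact ⟨C + C, fun x => (abs_sub _ _).trans (add_le_add (hC _) (hC x))⟩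

theorem bounded_const {G : Type*} (c : ℝ) : Bounded (fun _ : G => c) :=
  ⟨|c|, fun _ => le_rfl⟩

theorem Bounded.finset_sum {G ι : Type*} {f : ι → G → ℝ} (hf : ∀ i, Bounded (f i))
    (s : Finset ι) : Bounded (fun x => ∑ i ∈ s, f i x) := by
  choose C hC using hf
  exact ⟨∑ i ∈ s, C i, fun x =>
    (Finset.abs_sum_le_sum_abs _ _).trans (Finset.sum_le_sum fun i _ => hC i x)⟩

theorem summable_mul_of_abs_le {c u : ℕ → ℝ} {C : ℝ} (hc : Summable fun i => |c i|)
    (hu : ∀ i, |u i| ≤ C) : Summable fun i => c i * u i := by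
  refine Summable.of_norm_bounded (hc.mul_right C) fun i => ?_
  rw [Real.norm_eq_abs, abs_mul]
  exact mul_le_mul_of_nonneg_left (hu i) (abs_nonneg _)

theorem abs_tsum_mul_le {c u : ℕ → ℝ} {C : ℝ} (hc : Summable fun i => |c i|)
    (hu : ∀ i, |u i| ≤ C) : |∑' i, c i * u i| ≤ (∑' i, |c i|) * C := by
  rw [← tsum_mul_right, ← Real.norm_eq_abs]
  refine tsum_of_norm_bounded (hc.mul_right C).hasSum fun i => ?_
  rw [Real.norm_eq_abs, abs_mul]
  exact mul_le_mul_of_nonneg_left (hu i) (abs_nonneg _)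

theorem Bounded.tsum_mul {G : Type*} {c : ℕ → ℝ} {u : ℕ → G → ℝ} {C : ℝ}
    (hc : Summable fun i => |c i|) (hu : ∀ i x, |u i x| ≤ C) :
    Bounded (fun x => ∑' i, c i * u i x) :=
  ⟨_, fun x => abs_tsum_mul_le hc fun i => hu i x⟩

namespace IsUpperMean

variable {G : Type*} [AddCommGroup G] {M : (G → ℝ) → ℝ}

theorem le_of_forall_le (hM : IsUpperMean G M) {f : G → ℝ} (hf : Bounded f) {C : ℝ}
    (hC : ∀ x, f x ≤ C) : M f ≤ C :=
  (hM.mono f _ hf (bounded_const C) hC).trans_eq (hM.norming C)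

theorem translate_two_pow_sub (hM : IsUpperMean G M) {f : G → ℝ} (hf : Bounded f) (t : G)
    (n : ℕ) :
    M (fun x => f (x + 2 ^ n • t) - f x) = 2 ^ n * M (fun x => f (x + t) - f x) := by
  induction n with
  | zero => simp
  | succ n ih =>
    have h := hM.restr_add _ (hf.translate_sub (2 ^ n • t)) (2 ^ n • t)
    rw [ih] at h
    rw [pow_succ' (2 : ℝ), mul_assoc, ← h]
    congr 1
    funext x
    rw [pow_succ, mul_two, add_smul, ← add_assoc]
    ring

theorem translate_sub_nonpos (hM : IsUpperMean G M) {f : G → ℝ} (hf : Bounded f) (t : G) :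
    M (fun x => f (x + t) - f x) ≤ 0 := by
  obtain ⟨C, hC⟩ := id hf
  by_contra! hpos
  obtain ⟨n, hn⟩ := pow_unbounded_of_one_lt ((C + C) / M (fun x => f (x + t) - f x))
    (one_lt_two (α := ℝ))
  rw [div_lt_iff₀ hpos, ← hM.translate_two_pow_sub hf] at hn
  refine hn.not_ge (hM.le_of_forall_le (hf.translate_sub _) fun x => ?_)
  linarith [abs_le.1 (hC x), abs_le.1 (hC (x + 2 ^ n • t))]

theorem sum_mul_translate_sub_nonpos (hM : IsUpperMean G M) {f : G → ℝ} (hf : Bounded f)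
    (c : ℕ → ℝ) (t : ℕ → G) (n : ℕ) :
    M (fun x => ∑ i ∈ Finset.range n, c i * (f (x + t i) - f x)) ≤ 0 := by
  induction n with
  | zero => simp [hM.norming]
  | succ n ih =>
    simp only [Finset.sum_range_succ]
    refine (hM.subadd _ _ (Bounded.finset_sum (fun i => (hf.translate_sub (t i)).const_mul (c i)) _)
      ((hf.translate_sub (t n)).const_mul (c n))).trans (add_nonpos ih ?_)
    simpa only [mul_sub] using hM.translate_sub_nonpos (hf.const_mul (c n)) (t n)

theorem tsum_mul_translate_sub_nonpos (hM : IsUpperMean G M) {f : G → ℝ} (hf : Bounded f)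
    {c : ℕ → ℝ} (t : ℕ → G) (hc : Summable fun i => |c i|) :
    M (fun x => ∑' i, c i * (f (x + t i) - f x)) ≤ 0 := by
  obtain ⟨C, hC⟩ := id hf
  have hd : ∀ i x, |f (x + t i) - f x| ≤ C + C := fun i x =>
    (abs_sub _ _).trans (add_le_add (hC _) (hC x))
  have hlim : Tendsto (fun n => (∑' i, |c (i + n)|) * (C + C)) atTop (nhds 0) := by
    simpa using (tendsto_sum_nat_add fun i => |c i|).mul_const (C + C)
  refine ge_of_tendsto' hlim fun n => ?_
  have hcn : Summable fun i => |c (i + n)| := (summable_nat_add_iff n).2 hc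
  have htail : Bounded (fun x => ∑' i, c (i + n) * (f (x + t (i + n)) - f x)) :=
    Bounded.tsum_mul hcn fun i => hd (i + n)
  have hsplit : (fun x => ∑' i, c i * (f (x + t i) - f x)) = fun x =>
      ∑ i ∈ Finset.range n, c i * (f (x + t i) - f x) +
        ∑' i, c (i + n) * (f (x + t (i + n)) - f x) := by
    funext x
    exact ((summable_mul_of_abs_le hc fun i => hd i x).sum_add_tsum_nat_add n).symm
  rw [hsplit]
  have hle := hM.subadd _ _
    (Bounded.finset_sum (fun i => (hf.translate_sub (t i)).const_mul (c i)) (Finset.range n)) htail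
  have hfin := hM.sum_mul_translate_sub_nonpos hf c t n
  have htl := hM.le_of_forall_le htail fun x =>
    (le_abs_self _).trans (abs_tsum_mul_le hcn fun i => hd (i + n) x)
  linarith

end IsUpperMean

/-- general restricted additivity for absolutely convergent combinations of
translates. -/
theorem stmt1 {G : Type*} [AddCommGroup G] [Infinite G] (M : (G → ℝ) → ℝ)
    (hM : IsUpperMean G M) (f : G → ℝ) (hf : Bounded f)
    (c : ℕ → ℝ) (t : ℕ → G)
    (hsum : Summable fun i => |c i|) (hpos : 0 ≤ ∑' i, c i) :
    Bounded (fun x => ∑' i, c i * f (x + t i)) ∧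
    M (fun x => ∑' i, c i * f (x + t i)) = (∑' i, c i) * M f := by
  obtain ⟨C, hC⟩ := id hf
  have hg : Bounded (fun x => ∑' i, c i * f (x + t i)) :=
    Bounded.tsum_mul hsum fun i x => hC (x + t i)
  refine ⟨hg, ?_⟩
  have hd : ∀ (b : ℕ → ℝ), (Summable fun i => |b i|) →
      Bounded (fun x => ∑' i, b i * (f (x + t i) - f x)) := fun b hb =>
    Bounded.tsum_mul (C := C + C) hb fun i x => (abs_sub _ _).trans (add_le_add (hC _) (hC x))
  have hneg : Summable fun i => |-c i| := by simpa only [abs_neg] using hsum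
  have hdiff : ∀ x, ∑' i, c i * (f (x + t i) - f x) =
      ∑' i, c i * f (x + t i) - (∑' i, c i) * f x := fun x => by
    simp only [mul_sub]
    rw [(summable_mul_of_abs_le hsum fun i => hC (x + t i)).tsum_sub (hsum.of_abs.mul_right _),
      tsum_mul_right]
  have hcf := hf.const_mul (∑' i, c i)
  rw [← hM.homog _ hpos f hf]
  apply le_antisymm
  · have h := hM.subadd _ _ hcf (hd c hsum)
    simp only [hdiff, add_sub_cancel] at h
    have h0 := hM.tsum_mul_translate_sub_nonpos hf t hsum
    simp only [hdiff] at h0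
    linarith
  · have h := hM.subadd _ _ hg (hd _ hneg)
    have h0 := hM.tsum_mul_translate_sub_nonpos hf t hneg
    simp only [neg_mul, tsum_neg, hdiff, neg_sub, add_sub_cancel] at h h0
    linarith
end

section
/- Let G be an infinite commutative group, L a linear subspace of the bounded real functions on G, and M : L → ℝ a linear functional such that: (a) every constant function c belongs to L and M(c) = c; (b) M is monotone on L, i.e. f ≤ g pointwise and f, g ∈ L imply M(f) ≤ M(g); (c) L is closed in the sense that if a bounded function f has the property that for every ε > 0 there are g̲, ḡ ∈ L with g̲ ≤ f ≤ ḡ pointwise and M(ḡ) − M(g̲) < ε, then f ∈ L; and (d) for every bounded function f and every t ∈ G, the function x ↦ f(x+t) − f(x) belongs to L and M of it is 0. Then the upper envelope M^e, defined by M^e(f) = inf { M(g) : g ∈ L, g ≥ f pointwise } for every bounded f, is an upper mean on G whose restriction to L equals M. -/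
open scoped Pointwise BigOperators
open Filter

/-- a linear functional on a subspace of bounded functions satisfying
norming, monotonicity, closedness and vanishing on differences of translates has an
upper envelope which is an upper mean extending it. -/
theorem stmt4 {G : Type*} [AddCommGroup G] [Infinite G]
    (L : Set (G → ℝ)) (M : (G → ℝ) → ℝ)
    (hLb : ∀ f ∈ L, Bounded f)
    (hLadd : ∀ f ∈ L, ∀ g ∈ L, (fun x => f x + g x) ∈ L)
    (hLsmul : ∀ c : ℝ, ∀ f ∈ L, (fun x => c * f x) ∈ L)
    (hMadd : ∀ f ∈ L, ∀ g ∈ L, M (fun x => f x + g x) = M f + M g)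
    (hMsmul : ∀ c : ℝ, ∀ f ∈ L, M (fun x => c * f x) = c * M f)
    (hconst : ∀ c : ℝ, (fun _ : G => c) ∈ L ∧ M (fun _ => c) = c)
    (hmono : ∀ f ∈ L, ∀ g ∈ L, (∀ x, f x ≤ g x) → M f ≤ M g)
    (hclosed : ∀ f : G → ℝ, Bounded f →
      (∀ ε : ℝ, 0 < ε → ∃ g₁ ∈ L, ∃ g₂ ∈ L,
        (∀ x, g₁ x ≤ f x) ∧ (∀ x, f x ≤ g₂ x) ∧ M g₂ - M g₁ < ε) → f ∈ L)
    (hdiff : ∀ f : G → ℝ, Bounded f → ∀ t : G,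
      (fun x => f (x + t) - f x) ∈ L ∧ M (fun x => f (x + t) - f x) = 0) :
    IsUpperMean G (fun f => sInf {a : ℝ | ∃ g ∈ L, (∀ x, f x ≤ g x) ∧ a = M g}) ∧
    ∀ f ∈ L, sInf {a : ℝ | ∃ g ∈ L, (∀ x, f x ≤ g x) ∧ a = M g} = M f := by
  let E : (G → ℝ) → ℝ := fun f => sInf {a : ℝ | ∃ g ∈ L, (∀ x, f x ≤ g x) ∧ a = M g}
  have E_le {f : G → ℝ} (hf : Bounded f) {g : G → ℝ} (hg : g ∈ L) (h : ∀ x, f x ≤ g x) :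
      E f ≤ M g := by
    obtain ⟨C, hC⟩ := hf
    refine csInf_le ⟨-C, ?_⟩ ⟨g, hg, h, rfl⟩
    rintro _ ⟨u, hu, hfu, rfl⟩
    rw [← (hconst (-C)).2]
    exact hmono _ (hconst (-C)).1 _ hu fun x => (abs_le.1 (hC x)).1.trans (hfu x)
  have le_E {f : G → ℝ} (hf : Bounded f) {a : ℝ}
      (h : ∀ g ∈ L, (∀ x, f x ≤ g x) → a ≤ M g) : a ≤ E f := by
    obtain ⟨C, hC⟩ := hf
    refine le_csInf ⟨_, _, (hconst C).1, fun x => (abs_le.1 (hC x)).2, rfl⟩ ?_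
    rintro _ ⟨u, hu, hfu, rfl⟩
    exact h u hu hfu
  have bounded_add {f g : G → ℝ} (hf : Bounded f) (hg : Bounded g) :
      Bounded fun x => f x + g x := by
    obtain ⟨C, hC⟩ := hf
    obtain ⟨D, hD⟩ := hg
    exact ⟨C + D, fun x => (abs_add_le _ _).trans (add_le_add (hC x) (hD x))⟩
  have bounded_mul (c : ℝ) {f : G → ℝ} (hf : Bounded f) : Bounded fun x => c * f x := by
    obtain ⟨C, hC⟩ := hf
    refine ⟨|c| * C, fun x => ?_⟩
    rw [abs_mul]
    exact mul_le_mul_of_nonneg_left (hC x) (abs_nonneg c)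
  have E_eq {f : G → ℝ} (hf : f ∈ L) : E f = M f :=
    le_antisymm (E_le (hLb f hf) hf fun _ => le_rfl)
      (le_E (hLb f hf) fun g hg h => hmono f hf g hg h)
  have E_subadd {f g : G → ℝ} (hf : Bounded f) (hg : Bounded g) :
      E (fun x => f x + g x) ≤ E f + E g := by
    rw [← sub_le_iff_le_add]
    refine le_E hf fun u hu hfu => ?_
    rw [sub_le_comm]
    refine le_E hg fun v hv hgv => ?_
    rw [sub_le_iff_le_add', ← hMadd u hu v hv]
    exact E_le (bounded_add hf hg) (hLadd u hu v hv) fun x => add_le_add (hfu x) (hgv x)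
  have E_mul_le {c : ℝ} (hc : 0 < c) {f : G → ℝ} (hf : Bounded f) :
      E (fun x => c * f x) ≤ c * E f := by
    rw [← div_le_iff₀' hc]
    refine le_E hf fun g hg h => ?_
    rw [div_le_iff₀' hc, ← hMsmul c g hg]
    exact E_le (bounded_mul c hf) (hLsmul c g hg) fun x => mul_le_mul_of_nonneg_left (h x) hc.le
  have E_mul {c : ℝ} (hc : 0 ≤ c) {f : G → ℝ} (hf : Bounded f) :
      E (fun x => c * f x) = c * E f := by
    obtain rfl | hc := hc.eq_or_lt
    · simp only [zero_mul]
      rw [E_eq (hconst 0).1, (hconst 0).2]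
    · refine le_antisymm (E_mul_le hc hf) ?_
      have h := E_mul_le (inv_pos.2 hc) (bounded_mul c hf)
      simp only [inv_mul_cancel_left₀ hc.ne'] at h
      rwa [le_inv_mul_iff₀ hc] at h
  refine ⟨⟨fun c => (E_eq (hconst c).1).trans (hconst c).2, fun f g hf hg h => ?_,
    fun c hc f hf => E_mul hc hf, fun f hf t => ?_, fun f g hf hg => E_subadd hf hg⟩,
    fun f hf => E_eq hf⟩
  · exact le_E hg fun u hu hgu => E_le hf hu fun x => (h x).trans (hgu x)
  · obtain ⟨hd, hd0⟩ := hdiff f hf t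
    have hn := hLsmul (-1) _ hd
    have hft : Bounded fun x => f (x + t) := hf.imp fun C hC x => hC (x + t)
    change E (fun x => f x + f (x + t)) = 2 * E f
    rw [← E_mul zero_le_two hf]
    apply le_antisymm
    · have h := E_subadd (bounded_mul 2 hf) (hLb _ hd)
      rw [E_eq hd, hd0, add_zero] at h
      refine (congrArg E (funext fun x => ?_)).trans_le h
      ring
    · have h := E_subadd (bounded_add hf hft) (hLb _ hn)
      rw [E_eq hn, hMsmul (-1) _ hd, hd0, mul_zero, add_zero] at h
      refine (congrArg E (funext fun x => ?_)).trans_le h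
      ring
end

section
/- Let G be an infinite commutative group and let f, f', f'' : G → ℝ be bounded functions. If f is commarginal to f' and f' is commarginal to f'', then f is commarginal to f''. (Together with reflexivity and symmetry, commarginality is an equivalence relation on bounded functions.) -/
open scoped Pointwise BigOperators
open Filter

/-- Each row of a kernel supported near the diagonal has finite support. -/
theorem finite_support_row {G : Type*} [AddCommGroup G] {F : G → G → ℝ} {B : Finset G}
    (h : ∀ x y, F x y ≠ 0 → x - y ∈ B) (x : G) :
    (Function.support fun y => F x y).Finite := by
  refine (B.finite_toSet.image fun b => x - b).subset fun y hy => ?_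
  exact ⟨x - y, h x y hy, by simp⟩

/-- Each column of a kernel supported near the diagonal has finite support. -/
theorem finite_support_column {G : Type*} [AddCommGroup G] {F : G → G → ℝ} {B : Finset G}
    (h : ∀ x y, F x y ≠ 0 → x - y ∈ B) (y : G) :
    (Function.support fun x => F x y).Finite := by
  refine (B.finite_toSet.image fun b => b + y).subset fun x hx => ?_
  exact ⟨x - y, h x y hx, by simp⟩

/-- commarginality is transitive on bounded functions. -/
theorem stmt5 {G : Type*} [AddCommGroup G] [Infinite G]
    (f f' f'' : G → ℝ) (hf : Bounded f) (hf' : Bounded f') (hf'' : Bounded f'')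
    (h1 : Commarginal f f') (h2 : Commarginal f' f'') :
    Commarginal f f'' := by
  classical
  obtain ⟨F₁, B₁, ⟨C₁, hC₁⟩, hB₁, hrow₁, hcol₁⟩ := h1
  obtain ⟨F₂, B₂, ⟨C₂, hC₂⟩, hB₂, hrow₂, hcol₂⟩ := h2
  obtain ⟨C, hC⟩ := hf'
  let D : G → G → ℝ := fun x y => if x = y then f' x else 0
  have hD : ∀ x y, D x y ≠ 0 → x - y ∈ ({0} : Finset G) := by
    intro x y h
    by_cases hxy : x = y
    · simp [hxy]
    · simp [D, hxy] at h
  have hDbound : ∀ x y, |D x y| ≤ C := by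
    intro x y
    by_cases hxy : x = y
    · simpa [D, hxy] using hC y
    · simpa [D, hxy] using (abs_nonneg _).trans (hC x)
  have hDrow : ∀ x, ∑ᶠ y, D x y = f' x := by
    intro x
    rw [finsum_eq_single _ x fun y hy => by simp [D, hy.symm]]
    simp [D]
  have hDcol : ∀ y, ∑ᶠ x, D x y = f' y := by
    intro y
    rw [finsum_eq_single _ y fun x hx => by simp [D, hx]]
    simp [D]
  refine ⟨fun x y => F₁ x y + F₂ x y - D x y, B₁ ∪ B₂ ∪ {0}, ⟨C₁ + C₂ + C, ?_⟩, ?_, ?_, ?_⟩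
  · intro x y
    have h₁ := abs_le.mp (hC₁ x y)
    have h₂ := abs_le.mp (hC₂ x y)
    have h₃ := abs_le.mp (hDbound x y)
    exact abs_le.mpr ⟨by linarith, by linarith⟩
  · intro x y h
    by_contra hxy
    simp only [Finset.mem_union, not_or] at hxy
    have h₁ : F₁ x y = 0 := not_not.mp fun h => hxy.1.1 (hB₁ x y h)
    have h₂ : F₂ x y = 0 := not_not.mp fun h => hxy.1.2 (hB₂ x y h)
    have h₃ : D x y = 0 := not_not.mp fun h => hxy.2 (hD x y h)
    simp [h₁, h₂, h₃] at h
  · intro x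
    have h₁ := finite_support_row hB₁ x
    have h₂ := finite_support_row hB₂ x
    rw [finsum_sub_distrib ((h₁.union h₂).subset (Function.support_add _ _))
      (finite_support_row hD x), finsum_add_distrib h₁ h₂, hrow₁, hrow₂, hDrow,
      add_sub_cancel_right]
  · intro y
    have h₁ := finite_support_column hB₁ y
    have h₂ := finite_support_column hB₂ y
    rw [finsum_sub_distrib ((h₁.union h₂).subset (Function.support_add _ _))
      (finite_support_column hD y), finsum_add_distrib h₁ h₂, hcol₁, hcol₂, hDcol,
      add_sub_cancel_left]
end

section
/- Let G be an infinite commutative group. If bounded functions f, f' : G → ℝ are commarginal, then M̄(f) = M̄(f') for every upper mean M̄ on G. -/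
open scoped Pointwise BigOperators
open Filter

theorem Bounded.neg {G : Type*} {f : G → ℝ} (hf : Bounded f) : Bounded (fun x => -f x) := by
  obtain ⟨C, hC⟩ := hf
  exact ⟨C, fun x => by simpa using hC x⟩

theorem Bounded.sub {G : Type*} {f g : G → ℝ} (hf : Bounded f) (hg : Bounded g) :
    Bounded (fun x => f x - g x) := by
  simpa [sub_eq_add_neg] using hf.add hg.neg

theorem Bounded.comp {G H : Type*} {f : G → ℝ} (hf : Bounded f) (u : H → G) :
    Bounded (fun x => f (u x)) := by
  obtain ⟨C, hC⟩ := hf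
  exact ⟨C, fun x => hC (u x)⟩

/-- Telescoping a difference of translates along doubled steps. -/
theorem IsUpperMean.translate_sub_pow {G : Type*} [AddCommGroup G] {M : (G → ℝ) → ℝ}
    (hM : IsUpperMean G M) {h : G → ℝ} (hh : Bounded h) (b : G) (n : ℕ) :
    M (fun x => h (x + 2 ^ n • b) - h x) = 2 ^ n * M (fun x => h (x + b) - h x) := by
  induction n with
  | zero => simp
  | succ n ih =>
    have key := hM.restr_add _ ((hh.comp (fun x => x + 2 ^ n • b)).sub hh) (2 ^ n • b)
    rw [ih] at key
    rw [pow_succ' (2 : ℝ), mul_assoc, ← key]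
    congr 1
    funext x
    rw [pow_succ', mul_smul, two_smul, add_assoc]
    ring

theorem IsUpperMean.translate_sub_nonpos_s6 {G : Type*} [AddCommGroup G] {M : (G → ℝ) → ℝ}
    (hM : IsUpperMean G M) {h : G → ℝ} (hh : Bounded h) (b : G) :
    M (fun x => h (x + b) - h x) ≤ 0 := by
  obtain ⟨C, hC⟩ := id hh
  by_contra! hpos
  obtain ⟨n, hn⟩ := pow_unbounded_of_one_lt ((C + C) / M (fun x => h (x + b) - h x))
    (one_lt_two : (1 : ℝ) < 2)
  rw [div_lt_iff₀ hpos, ← hM.translate_sub_pow hh] at hn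
  refine hn.not_ge ?_
  rw [← hM.norming (C + C)]
  refine hM.mono _ _ ((hh.comp _).sub hh) ⟨|C + C|, fun _ => le_rfl⟩ fun x => ?_
  have h1 := (abs_le.1 (hC (x + 2 ^ n • b))).2
  have h2 := (abs_le.1 (hC x)).1
  linarith

/-- Translating finitely many bounded summands does not increase an upper mean. -/
theorem IsUpperMean.add_sum_translate_sub_le {G : Type*} [AddCommGroup G] {M : (G → ℝ) → ℝ}
    (hM : IsUpperMean G M) {f : G → ℝ} (hf : Bounded f) {k : G → G → ℝ}
    (hk : ∀ b, Bounded (k b)) (B : Finset G) :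
    Bounded (fun x => f x + ∑ b ∈ B, (k b (x + b) - k b x)) ∧
      M (fun x => f x + ∑ b ∈ B, (k b (x + b) - k b x)) ≤ M f := by
  classical
  induction B using Finset.induction_on with
  | empty => simpa using hf
  | insert b B hb ih =>
    have hd : Bounded (fun x => k b (x + b) - k b x) := ((hk b).comp _).sub (hk b)
    have heq : (fun x => f x + ∑ c ∈ insert b B, (k c (x + c) - k c x)) =
        fun x => (f x + ∑ c ∈ B, (k c (x + c) - k c x)) + (k b (x + b) - k b x) := by
      funext x
      rw [Finset.sum_insert hb]
      ring
    rw [heq]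
    refine ⟨ih.1.add hd, (hM.subadd _ _ ih.1 hd).trans ?_⟩
    linarith [ih.2, hM.translate_sub_nonpos_s6 (hk b) b]

/-- The marginals of a kernel supported near the diagonal, summed along diagonals. -/
theorem Commarginal.exists_diagonals {G : Type*} [AddCommGroup G] {f f' : G → ℝ}
    (h : Commarginal f f') : ∃ (k : G → G → ℝ) (B : Finset G), (∀ b, Bounded (k b)) ∧
      (∀ x, f x = ∑ b ∈ B, k b x) ∧ ∀ x, f' x = ∑ b ∈ B, k b (x + b) := by
  obtain ⟨F, B, ⟨C, hC⟩, hB, hf, hf'⟩ := h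
  refine ⟨fun b x => F x (x - b), B, fun b => ⟨C, fun x => hC _ _⟩, fun x => ?_, fun y => ?_⟩
  · rw [← hf, ← finsum_comp_equiv (Equiv.subLeft x)]
    refine finsum_eq_sum_of_support_subset _ fun b hb => ?_
    simpa using hB _ _ hb
  · rw [← hf', ← finsum_comp_equiv (Equiv.addLeft y)]
    simp only [add_sub_cancel_right]
    refine finsum_eq_sum_of_support_subset _ fun b hb => ?_
    simpa using hB _ _ hb

/-- commarginality is compatible with every upper mean. -/
theorem stmt6 {G : Type*} [AddCommGroup G] [Infinite G]
    (f f' : G → ℝ) (hf : Bounded f) (hf' : Bounded f')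
    (h : Commarginal f f') :
    ∀ M : (G → ℝ) → ℝ, IsUpperMean G M → M f = M f' := by
  intro M hM
  obtain ⟨k, B, hk, hfk, hfk'⟩ := h.exists_diagonals
  apply le_antisymm
  · refine (congrArg M ?_).trans_le (hM.add_sum_translate_sub_le hf' (fun b => (hk b).neg) B).2
    funext x
    simp only [hfk, hfk', Finset.sum_sub_distrib, Finset.sum_neg_distrib]
    ring
  · refine (congrArg M ?_).trans_le (hM.add_sum_translate_sub_le hf hk B).2
    funext x
    simp only [hfk, hfk', Finset.sum_sub_distrib]
    ring
end

section
/- Let G be an infinite commutative group. For every finite nonempty subset B ⊆ G and every ε > 0, there exists a finite nonempty subset C ⊆ G such that |B + C| < (1 + ε)·|C|, where B + C = { b + c : b ∈ B, c ∈ C } is the sumset. -/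
open scoped Pointwise BigOperators
open Filter

/-- Iterated sumsets in a commutative monoid have polynomial growth. -/
theorem card_nsmul_le_succ_pow_card {G : Type*} [AddCommMonoid G] [DecidableEq G]
    (B : Finset G) (n : ℕ) : (n • B).card ≤ (n + 1) ^ B.card := by
  classical
  have h : n • B ⊆ (Fintype.piFinset fun _ : B => Finset.range (n + 1)).image
      fun f => ∑ b : B, f b • (b : G) := by
    induction n with
    | zero =>
      intro x hx
      have hx' : x = 0 := by simpa using hx
      subst hx'
      exact Finset.mem_image.2 ⟨0, Fintype.mem_piFinset.2 fun _ => by simp, by simp⟩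
    | succ n ih =>
      intro x hx
      rw [succ_nsmul, Finset.mem_add] at hx
      obtain ⟨y, hy, b, hb, rfl⟩ := hx
      obtain ⟨f, hf, rfl⟩ := Finset.mem_image.1 (ih hy)
      rw [Fintype.mem_piFinset] at hf
      refine Finset.mem_image.2 ⟨f + Pi.single ⟨b, hb⟩ 1, ?_, ?_⟩
      · rw [Fintype.mem_piFinset]
        intro a
        have ha := Finset.mem_range.1 (hf a)
        have h1 : (Pi.single ⟨b, hb⟩ 1 : B → ℕ) a ≤ 1 := by
          rw [Pi.single_apply]
          split_ifs <;> omega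
        rw [Finset.mem_range, Pi.add_apply]
        omega
      · simp [add_smul, Finset.sum_add_distrib, Pi.single_apply, ite_smul]
  refine (Finset.card_le_card h).trans (Finset.card_image_le.trans ?_)
  simp [Fintype.card_piFinset]

/-- for every finite nonempty `B ⊆ G` and `ε > 0` there is a finite nonempty
`C` with `|B + C| < (1 + ε) |C|`. -/
theorem stmt7 {G : Type*} [AddCommGroup G] [Infinite G] [DecidableEq G]
    (B : Finset G) (hB : B.Nonempty) (ε : ℝ) (hε : 0 < ε) :
    ∃ C : Finset G, C.Nonempty ∧ ((B + C).card : ℝ) < (1 + ε) * (C.card : ℝ) := by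
  by_contra! hcon
  have hne (n : ℕ) : (n • B).Nonempty := by
    induction n with
    | zero => simp
    | succ n ih => rw [succ_nsmul]; exact ih.add hB
  have hgrow (n : ℕ) : (1 + ε) ^ n ≤ ((n • B).card : ℝ) := by
    induction n with
    | zero => simp
    | succ n ih =>
      rw [pow_succ', succ_nsmul']
      exact (mul_le_mul_of_nonneg_left ih (by positivity)).trans (hcon _ (hne n))
  have hlim := (tendsto_pow_const_div_const_pow_of_one_lt B.card
    (show 1 < 1 + ε by linarith)).comp (tendsto_add_atTop_nat 1)
  obtain ⟨n, hn⟩ := (hlim.eventually_lt_const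
    (show (0 : ℝ) < 1 / (1 + ε) by positivity)).exists
  have hle : (1 + ε) ^ n ≤ ((n + 1 : ℕ) : ℝ) ^ B.card :=
    (hgrow n).trans (by exact_mod_cast card_nsmul_le_succ_pow_card B n)
  rw [Function.comp_apply, div_lt_div_iff₀ (by positivity) (by positivity), pow_succ] at hn
  nlinarith
end

section
/- Let G be an infinite commutative group and f : G → ℝ a bounded function. Then M_*(f) = M*(f) (i.e. f is absolutely medial) if and only if f is limit-commarginal to a constant function (namely, to the constant function with value M*(f)). -/
open scoped Pointwise BigOperators
open Filter

/-- `T` is a finite convex combination of translation operators. -/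
def IsAveraging {G : Type*} [AddCommGroup G] (T : (G → ℝ) → G → ℝ) : Prop :=
  ∃ (n : ℕ) (c : Fin n → ℝ) (t : Fin n → G),
    (∀ i, 0 ≤ c i) ∧ (∑ i, c i) = 1 ∧ ∀ f x, T f x = ∑ i, c i * f (x + t i)

section Averaging

variable {G : Type*} [AddCommGroup G]

theorem IsAveraging.of_fintype {ι : Type*} [Fintype ι] (c : ι → ℝ) (t : ι → G)
    (hc : ∀ i, 0 ≤ c i) (hs : ∑ i, c i = 1) :
    IsAveraging (fun (f : G → ℝ) x => ∑ i, c i * f (x + t i)) := by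
  let e := (Fintype.equivFin ι).symm
  refine ⟨Fintype.card ι, c ∘ e, t ∘ e, fun i => hc _, ?_, fun f x => ?_⟩
  · rw [← hs]
    exact e.sum_comp c
  · exact (e.sum_comp fun i => c i * f (x + t i)).symm

theorem convexCombTranslates_iff {f g : G → ℝ} :
    ConvexCombTranslates f g ↔ ∃ T, IsAveraging T ∧ g = T f := by
  constructor
  · rintro ⟨n, c, t, hc, hs, h⟩
    exact ⟨fun f x => ∑ i, c i * f (x + t i), ⟨n, c, t, hc, hs, fun _ _ => rfl⟩, funext h⟩
  · rintro ⟨T, ⟨n, c, t, hc, hs, h⟩, rfl⟩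
    exact ⟨n, c, t, hc, hs, h f⟩

variable {S T : (G → ℝ) → G → ℝ}

theorem IsAveraging.id : IsAveraging (fun f : G → ℝ => f) :=
  ⟨1, fun _ => 1, fun _ => 0, by simp, by simp, by simp⟩

theorem IsAveraging.comp (hS : IsAveraging S) (hT : IsAveraging T) :
    IsAveraging (fun f => S (T f)) := by
  obtain ⟨n, c, t, hc, hs, h⟩ := hS
  obtain ⟨m, d, u, hd, hu, k⟩ := hT
  have key := IsAveraging.of_fintype (fun p : Fin n × Fin m => c p.1 * d p.2)
    (fun p => t p.1 + u p.2) (fun p => mul_nonneg (hc _) (hd _))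
    (by rw [Fintype.sum_prod_type, ← Finset.sum_mul_sum, hs, hu, one_mul])
  convert key using 3 with f x
  rw [h, Fintype.sum_prod_type]
  refine Finset.sum_congr rfl fun i _ => ?_
  rw [k, Finset.mul_sum]
  exact Finset.sum_congr rfl fun j _ => by rw [mul_assoc, add_assoc]

theorem IsAveraging.comm (hS : IsAveraging S) (hT : IsAveraging T) (f : G → ℝ) :
    S (T f) = T (S f) := by
  obtain ⟨n, c, t, -, -, h⟩ := hS
  obtain ⟨m, d, u, -, -, k⟩ := hT
  funext x
  simp only [h, k, Finset.mul_sum]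
  rw [Finset.sum_comm]
  refine Finset.sum_congr rfl fun j _ => Finset.sum_congr rfl fun i _ => ?_
  rw [add_right_comm]
  ring

theorem IsAveraging.map_add (hT : IsAveraging T) (f g : G → ℝ) (x : G) :
    T (fun x => f x + g x) x = T f x + T g x := by
  obtain ⟨n, c, t, -, -, h⟩ := hT
  simp only [h, mul_add, Finset.sum_add_distrib]

theorem IsAveraging.map_le (hT : IsAveraging T) {f : G → ℝ} {a : ℝ} (hf : ∀ x, f x ≤ a) (x : G) :
    T f x ≤ a := by
  obtain ⟨n, c, t, hc, hs, h⟩ := hT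
  rw [h, ← one_mul a, ← hs, Finset.sum_mul]
  exact Finset.sum_le_sum fun i _ => mul_le_mul_of_nonneg_left (hf _) (hc i)

theorem IsAveraging.le_map (hT : IsAveraging T) {f : G → ℝ} {a : ℝ} (hf : ∀ x, a ≤ f x) (x : G) :
    a ≤ T f x := by
  obtain ⟨n, c, t, hc, hs, h⟩ := hT
  rw [h, ← one_mul a, ← hs, Finset.sum_mul]
  exact Finset.sum_le_sum fun i _ => mul_le_mul_of_nonneg_left (hf _) (hc i)

theorem IsAveraging.abs_map_le (hT : IsAveraging T) {f : G → ℝ} {a : ℝ} (hf : ∀ x, |f x| ≤ a)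
    (x : G) : |T f x| ≤ a :=
  abs_le.2 ⟨hT.le_map (fun x => (abs_le.1 (hf x)).1) x, hT.map_le (fun x => (abs_le.1 (hf x)).2) x⟩

theorem Mstar_le (hT : IsAveraging T) {f : G → ℝ} (hf : Bounded f) {a : ℝ}
    (h : ∀ x, T f x ≤ a) : Mstar f ≤ a := by
  obtain ⟨C, hC⟩ := hf
  have hbdd : BddBelow {a : ℝ | ∃ g : G → ℝ, ConvexCombTranslates f g ∧
      a = sSup (Set.range g)} := by
    refine ⟨-C, ?_⟩
    rintro _ ⟨g, hg, rfl⟩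
    obtain ⟨S, hS, rfl⟩ := convexCombTranslates_iff.1 hg
    have hb := hS.abs_map_le hC
    exact (abs_le.1 (hb 0)).1.trans (le_csSup
      ⟨C, by rintro _ ⟨x, rfl⟩; exact (abs_le.1 (hb x)).2⟩ ⟨0, rfl⟩)
  refine (csInf_le hbdd ⟨T f, convexCombTranslates_iff.2 ⟨T, hT, rfl⟩, rfl⟩).trans ?_
  exact csSup_le (Set.range_nonempty _) (by rintro _ ⟨x, rfl⟩; exact h x)

theorem le_Mlowstar (hT : IsAveraging T) {f : G → ℝ} (hf : Bounded f) {a : ℝ}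
    (h : ∀ x, a ≤ T f x) : a ≤ Mlowstar f := by
  obtain ⟨C, hC⟩ := hf
  have hbdd : BddAbove {a : ℝ | ∃ g : G → ℝ, ConvexCombTranslates f g ∧
      a = sInf (Set.range g)} := by
    refine ⟨C, ?_⟩
    rintro _ ⟨g, hg, rfl⟩
    obtain ⟨S, hS, rfl⟩ := convexCombTranslates_iff.1 hg
    have hb := hS.abs_map_le hC
    exact (csInf_le ⟨-C, by rintro _ ⟨x, rfl⟩; exact (abs_le.1 (hb x)).1⟩ (Set.mem_range_self 0)).trans
      (abs_le.1 (hb 0)).2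
  refine le_trans ?_ (le_csSup hbdd ⟨T f, convexCombTranslates_iff.2 ⟨T, hT, rfl⟩, rfl⟩)
  exact le_csInf (Set.range_nonempty _) (by rintro _ ⟨x, rfl⟩; exact h x)

theorem exists_averaging_le {f : G → ℝ} (hf : Bounded f) {a : ℝ} (h : Mstar f < a) :
    ∃ T, IsAveraging T ∧ ∀ x, T f x ≤ a := by
  obtain ⟨C, hC⟩ := hf
  have hne : {a : ℝ | ∃ g : G → ℝ, ConvexCombTranslates f g ∧ a = sSup (Set.range g)}.Nonempty :=
    ⟨_, f, convexCombTranslates_iff.2 ⟨_, IsAveraging.id, rfl⟩, rfl⟩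
  obtain ⟨_, ⟨g, hg, rfl⟩, hlt⟩ := exists_lt_of_csInf_lt hne h
  obtain ⟨S, hS, rfl⟩ := convexCombTranslates_iff.1 hg
  exact ⟨S, hS, fun x => (le_csSup
    ⟨C, by rintro _ ⟨y, rfl⟩; exact (abs_le.1 (hS.abs_map_le hC y)).2⟩
    (Set.mem_range_self x)).trans hlt.le⟩

theorem exists_le_averaging {f : G → ℝ} (hf : Bounded f) {a : ℝ} (h : a < Mlowstar f) :
    ∃ T, IsAveraging T ∧ ∀ x, a ≤ T f x := by
  obtain ⟨C, hC⟩ := hf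
  have hne : {a : ℝ | ∃ g : G → ℝ, ConvexCombTranslates f g ∧ a = sInf (Set.range g)}.Nonempty :=
    ⟨_, f, convexCombTranslates_iff.2 ⟨_, IsAveraging.id, rfl⟩, rfl⟩
  obtain ⟨_, ⟨g, hg, rfl⟩, hlt⟩ := exists_lt_of_lt_csSup hne h
  obtain ⟨S, hS, rfl⟩ := convexCombTranslates_iff.1 hg
  exact ⟨S, hS, fun x => hlt.le.trans (csInf_le
    ⟨-C, by rintro _ ⟨y, rfl⟩; exact (abs_le.1 (hS.abs_map_le hC y)).1⟩
    (Set.mem_range_self x))⟩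

theorem Mlowstar_le_Mstar {f : G → ℝ} (hf : Bounded f) : Mlowstar f ≤ Mstar f := by
  refine le_of_forall_lt fun a ha => ?_
  by_contra! hle
  obtain ⟨b, hab, hb⟩ := exists_between ha
  obtain ⟨c, hac, hcb⟩ := exists_between hab
  obtain ⟨S, hS, h₁⟩ := exists_averaging_le hf (hle.trans_lt hac)
  obtain ⟨T, hT, h₂⟩ := exists_le_averaging hf hb
  have h := hS.le_map h₂ 0
  rw [hS.comm hT] at h
  linarith [hT.map_le h₁ 0]

/-- Some averages of `d` are uniformly arbitrarily small. -/
def AveragesToZero (d : G → ℝ) : Prop :=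
  ∀ ε : ℝ, 0 < ε → ∃ T, IsAveraging T ∧ ∀ x, |T d x| ≤ ε

theorem AveragesToZero.add {d e : G → ℝ} (hd : AveragesToZero d) (he : AveragesToZero e) :
    AveragesToZero (fun x => d x + e x) := by
  intro ε hε
  obtain ⟨S, hS, h₁⟩ := hd (ε / 2) (half_pos hε)
  obtain ⟨T, hT, h₂⟩ := he (ε / 2) (half_pos hε)
  refine ⟨_, hS.comp hT, fun x => ?_⟩
  rw [hS.comm hT, (hT.comp hS).map_add, ← hS.comm hT e]
  have h₃ := hT.abs_map_le h₁ x
  have h₄ := hS.abs_map_le h₂ x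
  linarith [abs_add_le (T (S d) x) (S (T e) x)]

theorem AveragesToZero.sum {ι : Type*} (s : Finset ι) (d : ι → G → ℝ)
    (h : ∀ i ∈ s, AveragesToZero (d i)) : AveragesToZero (fun x => ∑ i ∈ s, d i x) := by
  classical
  induction s using Finset.induction_on with
  | empty => exact fun ε hε => ⟨_, IsAveraging.id, by simp [hε.le]⟩
  | insert a s ha ih =>
    simp only [Finset.sum_insert ha]
    exact (h a (by simp)).add (ih fun i hi => h i (by simp [hi]))

theorem averagesToZero_sub_translate {h : G → ℝ} (hh : Bounded h) (b : G) :
    AveragesToZero (fun x => h x - h (x + b)) := by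
  intro ε hε
  obtain ⟨C, hC⟩ := hh
  obtain ⟨N, hN⟩ := exists_nat_gt (2 * C / ε)
  have hC0 : 0 ≤ C := (abs_nonneg _).trans (hC 0)
  have hN0 : (0 : ℝ) < N := lt_of_le_of_lt (by positivity) hN
  refine ⟨_, IsAveraging.of_fintype (fun _ : Fin N => (N : ℝ)⁻¹) (fun k => (k : ℕ) • b)
    (fun _ => by positivity) (by simp [hN0.ne']), fun x => ?_⟩
  have htel : ∑ k : Fin N, (N : ℝ)⁻¹ * (h (x + (k : ℕ) • b) - h (x + (k : ℕ) • b + b)) =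
      (N : ℝ)⁻¹ * (h x - h (x + N • b)) := by
    rw [← Finset.mul_sum,
      Fin.sum_univ_eq_sum_range fun k => h (x + k • b) - h (x + k • b + b)]
    have := Finset.sum_range_sub' (fun k : ℕ => h (x + k • b)) N
    simp only [succ_nsmul, ← add_assoc, zero_smul, add_zero] at this
    rw [this]
  rw [htel, abs_mul, abs_of_pos (inv_pos.2 hN0), inv_mul_le_iff₀ hN0]
  rw [div_lt_iff₀ hε] at hN
  linarith [abs_sub (h x) (h (x + N • b)), hC x, hC (x + N • b)]

theorem Commarginal.averagesToZero_sub {f f' : G → ℝ} (h : Commarginal f f') :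
    AveragesToZero (fun x => f x - f' x) := by
  classical
  obtain ⟨F, B, ⟨C, hC⟩, hB, hf, hf'⟩ := h
  have h₁ : ∀ x, f x = ∑ b ∈ B, F x (x - b) := by
    intro x
    rw [← hf, finsum_eq_sum_of_support_subset (s := B.image fun b => x - b),
      Finset.sum_image (fun a _ b _ hab => sub_right_injective hab)]
    intro y hy
    exact Finset.mem_coe.2 (Finset.mem_image.2 ⟨x - y, hB x y hy, by abel⟩)
  have h₂ : ∀ y, f' y = ∑ b ∈ B, F (y + b) y := by
    intro y
    rw [← hf', finsum_eq_sum_of_support_subset (s := B.image fun b => y + b),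
      Finset.sum_image (fun a _ b _ hab => add_right_injective _ hab)]
    intro x hx
    exact Finset.mem_coe.2 (Finset.mem_image.2 ⟨x - y, hB x y hx, by abel⟩)
  have key := AveragesToZero.sum B (fun b x => F x (x - b) - F (x + b) (x + b - b))
    fun b _ => averagesToZero_sub_translate (h := fun x => F x (x - b)) ⟨C, fun x => hC _ _⟩ b
  simpa only [add_sub_cancel_right, Finset.sum_sub_distrib, ← h₁, ← h₂] using key

theorem IsAveraging.commarginal (hT : IsAveraging T) {f : G → ℝ} (hf : Bounded f) :
    Commarginal f (T f) := by
  classical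
  obtain ⟨n, c, t, hc, hs, h⟩ := hT
  obtain ⟨C, hC⟩ := hf
  have hC0 : 0 ≤ C := (abs_nonneg _).trans (hC 0)
  refine ⟨fun x y => ∑ i, if x = y + t i then c i * f x else 0, Finset.univ.image t,
    ⟨C, fun x y => ?_⟩, fun x y hxy => ?_, fun x => ?_, fun y => ?_⟩
  · rw [← one_mul C, ← hs, Finset.sum_mul]
    refine (Finset.abs_sum_le_sum_abs _ _).trans (Finset.sum_le_sum fun i _ => ?_)
    split_ifs
    · rw [abs_mul, abs_of_nonneg (hc i)]
      exact mul_le_mul_of_nonneg_left (hC x) (hc i)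
    · simpa using mul_nonneg (hc i) hC0
  · obtain ⟨i, -, hi⟩ := Finset.exists_ne_zero_of_sum_ne_zero hxy
    have hx : x = y + t i := by
      by_contra hne
      exact hi (if_neg hne)
    exact Finset.mem_image.2 ⟨i, Finset.mem_univ _, by rw [hx]; abel⟩
  · have hz : ∀ i y, y ≠ x - t i → (if x = y + t i then c i * f x else 0) = 0 :=
      fun i y hy => if_neg fun hx => hy (by rw [hx]; abel)
    rw [finsum_sum_comm]
    · have : ∀ i, ∑ᶠ y, (if x = y + t i then c i * f x else 0) = c i * f x := fun i => by
        rw [finsum_eq_single _ (x - t i) (hz i), if_pos (by abel)]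
      simp only [this, ← Finset.sum_mul, hs, one_mul]
    · exact fun i _ => (Set.finite_singleton (x - t i)).subset fun y hy => by
        by_contra hne
        exact hy (hz i y hne)
  · rw [h, finsum_sum_comm]
    · refine Finset.sum_congr rfl fun i _ => ?_
      rw [finsum_eq_single _ (y + t i) fun x hx => if_neg hx, if_pos rfl]
    · exact fun i _ => (Set.finite_singleton (y + t i)).subset fun x hx => by
        by_contra hne
        exact hx (if_neg hne)

end Averaging

/-- a bounded function is absolutely medial iff it is limit-commarginal to
the constant function `M*(f)`. -/
theorem stmt10 {G : Type*} [AddCommGroup G] [Infinite G]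
    (f : G → ℝ) (hf : Bounded f) :
    Mlowstar f = Mstar f ↔ LimitCommarginal f (fun _ => Mstar f) := by
  constructor
  · intro heq
    have key : ∀ n : ℕ, ∃ T, IsAveraging T ∧ ∀ x, |T f x - Mstar f| ≤ 1 / ((n : ℝ) + 1) := by
      intro n
      have hpos : (0 : ℝ) < 1 / ((n : ℝ) + 1) := Nat.one_div_pos_of_nat
      obtain ⟨S, hS, h₁⟩ := exists_averaging_le hf (lt_add_of_pos_right (Mstar f) hpos)
      obtain ⟨T, hT, h₂⟩ := exists_le_averaging hf (heq ▸ sub_lt_self (Mstar f) hpos)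
      refine ⟨_, hS.comp hT, fun x => abs_le.2 ⟨?_, ?_⟩⟩
      · linarith [hS.le_map h₂ x]
      · rw [hS.comm hT]
        linarith [hT.map_le h₁ x]
    choose T hT hTf using key
    refine ⟨fun _ => f, fun n => T n f, fun _ => hf, fun n => ?_,
      fun n => (hT n).commarginal hf, fun ε hε => ⟨0, by simpa using hε⟩, fun ε hε => ?_⟩
    · obtain ⟨C, hC⟩ := hf
      exact ⟨C, (hT n).abs_map_le hC⟩
    · obtain ⟨N, hN⟩ := exists_nat_one_div_lt hε
      exact ⟨N, fun n hn x => (hTf n x).trans_lt ((Nat.one_div_le_one_div hn).trans_lt hN)⟩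
  · rintro ⟨g, g', -, -, hgg, hg, hg'⟩
    refine le_antisymm (Mlowstar_le_Mstar hf) (le_of_forall_pos_sub_le fun ε hε => ?_)
    have hε3 : 0 < ε / 3 := by positivity
    obtain ⟨N₁, h₁⟩ := hg _ hε3
    obtain ⟨N₂, h₂⟩ := hg' _ hε3
    set n := max N₁ N₂
    obtain ⟨T, hT, h₃⟩ := (hgg n).averagesToZero_sub _ hε3
    refine le_Mlowstar hT hf fun x => ?_
    have hsplit : f = fun x => (g n x - g' n x) + (f x - (g n x - g' n x)) := by
      funext x
      ring
    rw [hsplit, hT.map_add]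
    have h₄ : ∀ x, Mstar f - 2 * (ε / 3) ≤ f x - (g n x - g' n x) := fun x => by
      have ha := abs_lt.1 (h₁ n (le_max_left _ _) x)
      have hb := abs_lt.1 (h₂ n (le_max_right _ _) x)
      linarith [ha.2, hb.1]
    rw [← hsplit]
    linarith [hT.le_map h₄ x, (abs_le.1 (h₃ x)).1]
end

section
/- Let G be an infinite commutative group and f : G → ℝ a bounded function with f ≥ 0 pointwise. Then M*(f) = E(f) = inf over finite nonempty B ⊆ G of sup_{t∈G} (f|B)(t), where E(f) is the expansion pseudomean and (f|B) is the B-average of f. -/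
open scoped Pointwise BigOperators
open Filter

/-- The sums `∑ t ∈ T, k t • t` with `k t ≤ n` for all `t`. -/
def sumBox {G : Type*} [AddCommGroup G] [DecidableEq G] (T : Finset G) (n : ℕ) : Finset G :=
  (Fintype.piFinset fun _ : T => Finset.range (n + 1)).image fun k => ∑ t : T, k t • (t : G)

theorem sumBox_nonempty {G : Type*} [AddCommGroup G] [DecidableEq G] (T : Finset G) (n : ℕ) :
    (sumBox T n).Nonempty := by
  refine Finset.Nonempty.image ⟨fun _ => 0, ?_⟩ _
  simp [Fintype.mem_piFinset]

theorem card_sumBox_le {G : Type*} [AddCommGroup G] [DecidableEq G] (T : Finset G) (n : ℕ) :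
    (sumBox T n).card ≤ (n + 1) ^ T.card := by
  refine Finset.card_image_le.trans ?_
  simp [Fintype.card_piFinset]

theorem sumBox_add_subset {G : Type*} [AddCommGroup G] [DecidableEq G] (T : Finset G) (n : ℕ) :
    sumBox T n + T ⊆ sumBox T (n + 1) := by
  intro x hx
  obtain ⟨y, hy, s, hs, rfl⟩ := Finset.mem_add.1 hx
  obtain ⟨k, hk, rfl⟩ := Finset.mem_image.1 hy
  refine Finset.mem_image.2 ⟨k + Pi.single ⟨s, hs⟩ 1, ?_, ?_⟩
  · rw [Fintype.mem_piFinset] at hk ⊢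
    intro t
    have h := Finset.mem_range.1 (hk t)
    have h' : (Pi.single ⟨s, hs⟩ 1 : T → ℕ) t ≤ 1 := by
      rw [Pi.single_apply]; split_ifs <;> simp
    rw [Finset.mem_range, Pi.add_apply]
    omega
  · simp only [Pi.add_apply, add_smul, Finset.sum_add_distrib]
    congr 1
    rw [Finset.sum_eq_single ⟨s, hs⟩]
    · simp
    · intro b _ hb
      simp [Pi.single_eq_of_ne hb]
    · simp

/-- A commutative group has almost `T`-invariant finite sets. -/
theorem exists_card_add_le {G : Type*} [AddCommGroup G] [DecidableEq G] (T : Finset G)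
    {ε : ℝ} (hε : 0 < ε) :
    ∃ F : Finset G, F.Nonempty ∧ ((F + T).card : ℝ) ≤ (1 + ε) * F.card := by
  by_contra! h
  have hexp : ∀ n, (1 + ε) ^ n ≤ ((sumBox T n).card : ℝ) := by
    intro n
    induction n with
    | zero =>
      have := (sumBox_nonempty T 0).card_pos
      simpa using this
    | succ n ih =>
      calc (1 + ε) ^ (n + 1) = (1 + ε) * (1 + ε) ^ n := pow_succ' _ _
        _ ≤ (1 + ε) * (sumBox T n).card := by gcongr
        _ ≤ ((sumBox T n + T).card : ℝ) := (h _ (sumBox_nonempty T n)).le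
        _ ≤ _ := by exact_mod_cast Finset.card_le_card (sumBox_add_subset T n)
  have hlim := (tendsto_pow_const_div_const_pow_of_one_lt T.card
    (show 1 < 1 + ε by linarith)).comp (tendsto_add_atTop_nat 1)
  obtain ⟨n, hn⟩ := (hlim.eventually_lt_const
    (show (0 : ℝ) < (1 + ε)⁻¹ by positivity)).exists
  have hpoly : ((sumBox T n).card : ℝ) ≤ ((n + 1 : ℕ) : ℝ) ^ T.card := by
    exact_mod_cast card_sumBox_le T n
  have hlt : ((n + 1 : ℕ) : ℝ) ^ T.card < (1 + ε) ^ n := by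
    rw [Function.comp_apply, div_lt_iff₀ (by positivity), pow_succ'] at hn
    rwa [inv_mul_cancel_left₀ (by positivity)] at hn
  linarith [hexp n]

theorem Bounded.exists_nonneg_le {G : Type*} {f : G → ℝ} (hf : Bounded f) :
    ∃ C, 0 ≤ C ∧ ∀ x, f x ≤ C := by
  obtain ⟨C, hC⟩ := hf
  exact ⟨max C 0, le_max_right _ _, fun x => (le_abs_self _).trans ((hC x).trans (le_max_left _ _))⟩

theorem ConvexCombTranslates.bddAbove_range {G : Type*} [AddCommGroup G] {f g : G → ℝ}
    (hf : Bounded f) (hg : ConvexCombTranslates f g) : BddAbove (Set.range g) := by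
  obtain ⟨C, -, hC⟩ := hf.exists_nonneg_le
  obtain ⟨n, c, t, hc, hsum, hg⟩ := hg
  refine ⟨C, ?_⟩
  rintro _ ⟨x, rfl⟩
  calc g x ≤ ∑ i, c i * C := by
        rw [hg]
        exact Finset.sum_le_sum fun i _ => mul_le_mul_of_nonneg_left (hC _) (hc i)
    _ = C := by rw [← Finset.sum_mul, hsum, one_mul]

theorem ConvexCombTranslates.nonneg {G : Type*} [AddCommGroup G] {f g : G → ℝ}
    (hpos : ∀ x, 0 ≤ f x) (hg : ConvexCombTranslates f g) (x : G) : 0 ≤ g x := by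
  obtain ⟨n, c, t, hc, -, hg⟩ := hg
  rw [hg]
  exact Finset.sum_nonneg fun i _ => mul_nonneg (hc i) (hpos _)

theorem convexCombTranslates_avg {G : Type*} [AddCommGroup G] (f : G → ℝ) {B : Finset G}
    (hB : B.Nonempty) : ConvexCombTranslates f (avg f B) := by
  have hcard : (B.card : ℝ) ≠ 0 := by exact_mod_cast hB.card_pos.ne'
  refine ⟨B.card, fun _ => (B.card : ℝ)⁻¹, fun i => B.equivFin.symm i, fun _ => by positivity,
    by simp [hcard], fun x => ?_⟩
  rw [avg, ← Finset.mul_sum, div_eq_inv_mul, ← Finset.sum_coe_sort,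
    ← B.equivFin.symm.sum_comp]
  simp only [add_comm x]

theorem convexCombTranslates_self {G : Type*} [AddCommGroup G] (f : G → ℝ) :
    ConvexCombTranslates f f :=
  ⟨1, fun _ => 1, fun _ => 0, by simp, by simp, by simp⟩

theorem ConvexCombTranslates.exists_sum_le {G : Type*} [AddCommGroup G] [DecidableEq G]
    {f g : G → ℝ} (hpos : ∀ x, 0 ≤ f x) (hg : ConvexCombTranslates f g) {a : ℝ}
    (ha : ∀ x, g x ≤ a) :
    ∃ T : Finset G, T.Nonempty ∧ ∀ B : Finset G, ∑ b ∈ B, f b ≤ a * (B + T).card := by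
  obtain ⟨n, c, t, hc, hsum, hg⟩ := hg
  have hn : (Finset.univ : Finset (Fin n)).Nonempty := by
    by_contra h
    rw [Finset.not_nonempty_iff_eq_empty] at h
    simp [h] at hsum
  refine ⟨Finset.univ.image fun i => -t i, hn.image _, fun B => ?_⟩
  set T : Finset G := Finset.univ.image fun i => -t i
  calc ∑ b ∈ B, f b = ∑ i, c i * ∑ b ∈ B, f b := by rw [← Finset.sum_mul, hsum, one_mul]
    _ ≤ ∑ i, c i * ∑ x ∈ B + T, f (x + t i) := by
      refine Finset.sum_le_sum fun i _ => mul_le_mul_of_nonneg_left ?_ (hc i)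
      have himg : B.image (fun b => b + -t i) ⊆ B + T := by
        intro x hx
        obtain ⟨b, hb, rfl⟩ := Finset.mem_image.1 hx
        exact Finset.add_mem_add hb (Finset.mem_image_of_mem _ (Finset.mem_univ i))
      refine le_trans (le_of_eq ?_)
        (Finset.sum_le_sum_of_subset_of_nonneg himg fun x _ _ => hpos _)
      rw [Finset.sum_image fun x _ y _ h => add_right_cancel h]
      simp
    _ = ∑ x ∈ B + T, g x := by
      simp only [hg, Finset.mul_sum]
      exact Finset.sum_comm
    _ ≤ ∑ _x ∈ B + T, a := Finset.sum_le_sum fun x _ => ha x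
    _ = a * (B + T).card := by rw [Finset.sum_const, nsmul_eq_mul, mul_comm]

theorem Epm_le_Mstar {G : Type*} [AddCommGroup G] [DecidableEq G] {f : G → ℝ}
    (hf : Bounded f) (hpos : ∀ x, 0 ≤ f x) : Epm f ≤ Mstar f := by
  refine le_csInf ⟨_, f, convexCombTranslates_self f, rfl⟩ ?_
  rintro _ ⟨g, hg, rfl⟩
  obtain ⟨T, hT, hB⟩ := hg.exists_sum_le hpos
    fun x => le_csSup (hg.bddAbove_range hf) (Set.mem_range_self x)
  refine (ciInf_le ⟨0, ?_⟩ ⟨T, hT⟩).trans (Real.iSup_le (fun B => ?_) ?_)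
  · rintro _ ⟨T, rfl⟩
    exact Real.iSup_nonneg fun B =>
      div_nonneg (Finset.sum_nonneg fun b _ => hpos b) (Nat.cast_nonneg _)
  · rw [div_le_iff₀ (by exact_mod_cast (B.2.add hT).card_pos)]
    exact hB B.1
  · exact Real.sSup_nonneg (by rintro _ ⟨x, rfl⟩; exact hg.nonneg hpos x)

theorem Mstar_le_iInf_avg {G : Type*} [AddCommGroup G] {f : G → ℝ} (hpos : ∀ x, 0 ≤ f x) :
    Mstar f ≤ ⨅ B : {B : Finset G // B.Nonempty}, ⨆ t : G, avg f B.1 t := by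
  have : Nonempty {B : Finset G // B.Nonempty} := ⟨⟨{0}, by simp⟩⟩
  refine le_ciInf fun B => csInf_le ⟨0, ?_⟩ ⟨_, convexCombTranslates_avg f B.2, rfl⟩
  rintro _ ⟨g, hg, rfl⟩
  exact Real.sSup_nonneg (by rintro _ ⟨x, rfl⟩; exact hg.nonneg hpos x)

theorem iInf_avg_le_Epm {G : Type*} [AddCommGroup G] [DecidableEq G] {f : G → ℝ}
    (hf : Bounded f) (hpos : ∀ x, 0 ≤ f x) :
    ⨅ B : {B : Finset G // B.Nonempty}, ⨆ t : G, avg f B.1 t ≤ Epm f := by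
  have : Nonempty {B : Finset G // B.Nonempty} := ⟨⟨{0}, by simp⟩⟩
  obtain ⟨C, hC0, hC⟩ := hf.exists_nonneg_le
  refine le_ciInf fun T => ?_
  set e : ℝ := ⨆ B : {B : Finset G // B.Nonempty}, (∑ b ∈ B.1, f b) / ((B.1 + T.1).card : ℝ)
  have he0 : 0 ≤ e := Real.iSup_nonneg fun B =>
    div_nonneg (Finset.sum_nonneg fun b _ => hpos b) (Nat.cast_nonneg _)
  have hbdd : BddAbove (Set.range fun B : {B : Finset G // B.Nonempty} =>
      (∑ b ∈ B.1, f b) / ((B.1 + T.1).card : ℝ)) := by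
    refine ⟨C, ?_⟩
    rintro _ ⟨B, rfl⟩
    refine div_le_of_le_mul₀ (Nat.cast_nonneg _) hC0 ?_
    calc ∑ b ∈ B.1, f b ≤ B.1.card • C := Finset.sum_le_card_nsmul _ _ _ fun b _ => hC b
      _ = C * B.1.card := by rw [nsmul_eq_mul, mul_comm]
      _ ≤ C * (B.1 + T.1).card := by
        have := Finset.card_le_card_add_right (s := B.1) T.2
        gcongr
  have hsum : ∀ B : Finset G, B.Nonempty → ∑ b ∈ B, f b ≤ e * (B + T.1).card := by
    intro B hB
    rw [← div_le_iff₀ (by exact_mod_cast (hB.add T.2).card_pos)]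
    exact le_ciSup hbdd ⟨B, hB⟩
  clear_value e
  have key : ∀ ε : ℝ, 0 < ε →
      ⨅ B : {B : Finset G // B.Nonempty}, ⨆ t : G, avg f B.1 t ≤ e * (1 + ε) := by
    intro ε hε
    obtain ⟨F, hF, hFT⟩ := exists_card_add_le T.1 hε
    refine (ciInf_le ⟨0, ?_⟩ ⟨F, hF⟩).trans (ciSup_le fun t => ?_)
    · rintro _ ⟨B, rfl⟩
      exact Real.iSup_nonneg fun t =>
        div_nonneg (Finset.sum_nonneg fun b _ => hpos _) (Nat.cast_nonneg _)
    · rw [avg, div_le_iff₀ (by exact_mod_cast hF.card_pos)]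
      calc ∑ b ∈ F, f (b + t) = ∑ b ∈ F + {t}, f b := by
            rw [Finset.add_singleton, Finset.vadd_finset_def,
              Finset.sum_image ((AddAction.injective _).injOn)]
            rfl
        _ ≤ e * (F + {t} + T.1).card := hsum (F + {t}) (hF.add (Finset.singleton_nonempty t))
        _ = e * (F + T.1).card := by
            rw [add_right_comm, Finset.card_add_singleton]
        _ ≤ e * ((1 + ε) * F.card) := mul_le_mul_of_nonneg_left hFT he0
        _ = e * (1 + ε) * F.card := by ring
  refine le_of_forall_pos_le_add fun δ hδ => (key (δ / (e + 1)) (by positivity)).trans ?_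
  have : e * (δ / (e + 1)) ≤ δ := by
    rw [mul_div_assoc', div_le_iff₀ (by positivity)]
    nlinarith
  linarith

/-- for nonnegative bounded `f`, the uppermost mean, the expansion
pseudomean, and the inf over finite nonempty `B` of `sup_t (f|B)(t)` all coincide. -/
theorem stmt11 {G : Type*} [AddCommGroup G] [Infinite G] [DecidableEq G]
    (f : G → ℝ) (hf : Bounded f) (hpos : ∀ x, 0 ≤ f x) :
    Mstar f = Epm f ∧
    Epm f = ⨅ B : {B : Finset G // B.Nonempty}, ⨆ t : G, avg f B.1 t := by
  have hle := Epm_le_Mstar hf hpos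
  have hMA := Mstar_le_iInf_avg hpos
  have hAE := iInf_avg_le_Epm hf hpos
  exact ⟨le_antisymm (hMA.trans hAE) hle, le_antisymm (hle.trans hMA) hAE⟩
end
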